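/- For all w, w' ∈ S_n, one has τ(g_w·g_{w'}) = 1 if w' = w^{−1} and τ(g_w·g_{w'}) = 0 otherwise. More generally, for every A in the subalgebra R[t_1,…,t_n] of H_{n,r}, τ(A·g_w·g_{w'}) = τ(A) if w' = w^{−1} and τ(A·g_w·g_{w'}) = 0 if w' ≠ w^{−1}. -/

import Mathlib

open Polynomial

namespace MAK

noncomputable section

variable (R : Type*) [CommRing R] (n r : ℕ) (q Δ : Rˣ) (u : Fin r → R) (F : Fin r → R[X])

/-- The free `R`-algebra on generators `t_1, …, t_n` (left) and `T_1, …, T_{n-1}` (right). -/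
abbrev FA := FreeAlgebra R (Fin n ⊕ Fin (n - 1))

/-- The generators `t_i`. -/
def tf (i : Fin n) : FA R n := FreeAlgebra.ι R (Sum.inl i)

/-- The generators `T_j`. -/
def Tf (j : Fin (n - 1)) : FA R n := FreeAlgebra.ι R (Sum.inr j)

/-- The index `j`, viewed in `Fin n`. -/
def lo (j : Fin (n - 1)) : Fin n := ⟨j.1, by have := j.2; omega⟩

/-- The index `j + 1`, viewed in `Fin n`. -/
def hi (j : Fin (n - 1)) : Fin n := ⟨j.1 + 1, by have := j.2; omega⟩

/-- The element `B_j = Δ⁻² Σ_{c1<c2} (u_{c2} - u_{c1})(q - q⁻¹) F_{c1}(t_j) F_{c2}(t_{j+1})`. -/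
def Bel (j : Fin (n - 1)) : FA R n :=
  ∑ c2 : Fin r, ∑ c1 ∈ Finset.univ.filter (fun c1 => c1 < c2),
    (((Δ⁻¹ : Rˣ) : R) ^ 2 * ((u c2 - u c1) * ((q : R) - ((q⁻¹ : Rˣ) : R)))) •
      (aeval (tf R n (lo n j)) (F c1) * aeval (tf R n (hi n j)) (F c2))

/-- The defining relations of the modified Ariki-Koike algebra. -/
inductive Rel : FA R n → FA R n → Prop
  | quad (j : Fin (n - 1)) :
      Rel ((Tf R n j - algebraMap R (FA R n) (q : R)) *
        (Tf R n j + algebraMap R (FA R n) ((q⁻¹ : Rˣ) : R))) 0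
  | tord (i : Fin n) : Rel (aeval (tf R n i) (∏ c : Fin r, (X - C (u c)))) 0
  | braid (j k : Fin (n - 1)) (h : k.1 = j.1 + 1) :
      Rel (Tf R n j * Tf R n k * Tf R n j) (Tf R n k * Tf R n j * Tf R n k)
  | Tcomm (j k : Fin (n - 1)) (h : j.1 + 2 ≤ k.1 ∨ k.1 + 2 ≤ j.1) :
      Rel (Tf R n j * Tf R n k) (Tf R n k * Tf R n j)
  | tcomm (i i' : Fin n) : Rel (tf R n i * tf R n i') (tf R n i' * tf R n i)
  | Tt (j : Fin (n - 1)) (i : Fin n) (h1 : i ≠ lo n j) (h2 : i ≠ hi n j) :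
      Rel (Tf R n j * tf R n i) (tf R n i * Tf R n j)
  | Thi (j : Fin (n - 1)) :
      Rel (Tf R n j * tf R n (hi n j)) (tf R n (lo n j) * Tf R n j + Bel R n r q Δ u F j)
  | Tlo (j : Fin (n - 1)) :
      Rel (Tf R n j * tf R n (lo n j)) (tf R n (hi n j) * Tf R n j - Bel R n r q Δ u F j)

/-- The modified Ariki-Koike algebra `H_{n,r}(R, q, u_1, …, u_r)`. -/
abbrev Hnr := RingQuot (Rel R n r q Δ u F)

/-- The canonical projection. -/
def pim : FA R n →ₐ[R] Hnr R n r q Δ u F := RingQuot.mkAlgHom R (Rel R n r q Δ u F)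

/-- The generator `t_i` of `H_{n,r}`. -/
def tt (i : Fin n) : Hnr R n r q Δ u F := pim R n r q Δ u F (tf R n i)

/-- The generator `T_j` of `H_{n,r}`. -/
def TT (j : Fin (n - 1)) : Hnr R n r q Δ u F := pim R n r q Δ u F (Tf R n j)

/-- The Lagrange basis polynomial `∏_{j ≠ c} (X - u_j)/(u_c - u_j)`. -/
def bpoly (c : Fin r) : R[X] :=
  ∏ j ∈ Finset.univ.filter (fun j => j ≠ c), Ring.inverse (u c - u j) • (X - C (u j))

/-- The idempotent `b_{k_1, …, k_n}`. -/
def b (k : Fin n → Fin r) : Hnr R n r q Δ u F :=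
  (List.ofFn fun i : Fin n => aeval (tt R n r q Δ u F i) (bpoly R r u (k i))).prod

/-- The element `B'_{i,j} = -(q - q⁻¹) Σ_{k_i < k_j} b_{k_1, …, k_n}`. -/
def B' (i j : Fin n) : Hnr R n r q Δ u F :=
  -(((q : R) - ((q⁻¹ : Rˣ) : R)) •
    ∑ k ∈ Finset.univ.filter (fun k : Fin n → Fin r => k i < k j), b R n r q Δ u F k)

/-- The element `g_i := T_i + B'_{i,i+1}`. -/
def g (j : Fin (n - 1)) : Hnr R n r q Δ u F :=
  TT R n r q Δ u F j + B' R n r q Δ u F (lo n j) (hi n j)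

/-- The idempotent `e_{i,j} = Σ_{k_i = k_j} b_{k_1, …, k_n}`. -/
def eij (i j : Fin n) : Hnr R n r q Δ u F :=
  ∑ k ∈ Finset.univ.filter (fun k : Fin n → Fin r => k i = k j), b R n r q Δ u F k

/-- The idempotent `e_i = e_{i,i+1}`. -/
def ee (j : Fin (n - 1)) : Hnr R n r q Δ u F := eij R n r q Δ u F (lo n j) (hi n j)

/-- The simple transposition `s_j = (j, j+1)` in `S_n`. -/
def simple (j : Fin (n - 1)) : Equiv.Perm (Fin n) := Equiv.swap (lo n j) (hi n j)

/-- `l` is a reduced word for the permutation `w`. -/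
def IsReducedWord (w : Equiv.Perm (Fin n)) (l : List (Fin (n - 1))) : Prop :=
  (l.map (simple n)).prod = w ∧
    ∀ l' : List (Fin (n - 1)), (l'.map (simple n)).prod = w → l.length ≤ l'.length

/-- The element `g_w = g_{i_1} ⋯ g_{i_l}` associated to a word `l = (i_1, …, i_l)`. -/
def gword (l : List (Fin (n - 1))) : Hnr R n r q Δ u F := (l.map (g R n r q Δ u F)).prod

/-- The element `T_w = T_{i_1} ⋯ T_{i_l}` associated to a word `l = (i_1, …, i_l)`. -/
def Tword (l : List (Fin (n - 1))) : Hnr R n r q Δ u F := (l.map (TT R n r q Δ u F)).prod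

/-- The monomial `t_1^{c_1} ⋯ t_n^{c_n}`. -/
def tmon (c : Fin n → ℕ) : Hnr R n r q Δ u F :=
  (List.ofFn fun i : Fin n => tt R n r q Δ u F i ^ c i).prod

end

end MAK

open MAK


namespace MAK

section Words

variable {n : ℕ}

theorem lo_lt_hi (j : Fin (n - 1)) : lo n j < hi n j := by
  simp [lo, hi, Fin.lt_def]

theorem simple_mul_self (j : Fin (n - 1)) : simple n j * simple n j = 1 :=
  Equiv.swap_mul_self _ _

theorem simple_mul_cancel (j : Fin (n - 1)) (w : Equiv.Perm (Fin n)) :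
    simple n j * (simple n j * w) = w := by
  rw [← mul_assoc, simple_mul_self, one_mul]

theorem simple_lo (j : Fin (n - 1)) : simple n j (lo n j) = hi n j := Equiv.swap_apply_left _ _

theorem simple_hi (j : Fin (n - 1)) : simple n j (hi n j) = lo n j := Equiv.swap_apply_right _ _

theorem simple_of_ne (j : Fin (n - 1)) {i : Fin n} (h1 : i ≠ lo n j) (h2 : i ≠ hi n j) :
    simple n j i = i := Equiv.swap_apply_of_ne_of_ne h1 h2

theorem simple_val (j : Fin (n - 1)) (a : Fin n) : (simple n j a).1 =
    if a.1 = j.1 then j.1 + 1 else if a.1 = j.1 + 1 then j.1 else a.1 := by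
  simp only [simple, Equiv.swap_apply_def, lo, hi, Fin.ext_iff]
  split_ifs <;> rfl

/-- `j` is a left descent of `w`. -/
def Desc (j : Fin (n - 1)) (w : Equiv.Perm (Fin n)) : Prop := w⁻¹ (hi n j) < w⁻¹ (lo n j)

theorem not_desc_iff {j : Fin (n - 1)} {w : Equiv.Perm (Fin n)} :
    ¬ Desc j w ↔ w⁻¹ (lo n j) < w⁻¹ (hi n j) := by
  have h : w⁻¹ (lo n j) ≠ w⁻¹ (hi n j) := fun h => (lo_lt_hi j).ne (w⁻¹.injective h)
  unfold Desc
  rw [not_lt]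
  exact ⟨fun h' => lt_of_le_of_ne h' h, le_of_lt⟩

theorem inv_simple_mul_apply (j : Fin (n - 1)) (w : Equiv.Perm (Fin n)) (a : Fin n) :
    (simple n j * w)⁻¹ a = w⁻¹ (simple n j a) := by
  simp [mul_inv_rev, simple]

theorem desc_simple_mul {j : Fin (n - 1)} {w : Equiv.Perm (Fin n)} :
    Desc j (simple n j * w) ↔ ¬ Desc j w := by
  rw [not_desc_iff, Desc, inv_simple_mul_apply, inv_simple_mul_apply, simple_lo, simple_hi]

/-- The inversions of `w⁻¹`. -/
def invSet (w : Equiv.Perm (Fin n)) : Finset (Fin n × Fin n) :=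
  Finset.univ.filter fun p => p.1 < p.2 ∧ w⁻¹ p.2 < w⁻¹ p.1

/-- The Coxeter length of a permutation. -/
def invNum (w : Equiv.Perm (Fin n)) : ℕ := (invSet w).card

theorem invNum_one : invNum (1 : Equiv.Perm (Fin n)) = 0 := by
  simp only [invNum, invSet, Finset.card_eq_zero, Finset.filter_eq_empty_iff]
  rintro p - ⟨h1, h2⟩
  exact lt_asymm h1 h2

theorem invNum_simple_mul {j : Fin (n - 1)} {w : Equiv.Perm (Fin n)} (h : ¬ Desc j w) :
    invNum (simple n j * w) = invNum w + 1 := by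
  have key : invSet (simple n j * w) = insert (lo n j, hi n j)
      ((invSet w).map ((simple n j).prodCongr (simple n j)).toEmbedding) := by
    ext ⟨a, b⟩
    have hs : (simple n j).symm = simple n j := Equiv.symm_swap _ _
    rw [Finset.mem_insert, Finset.mem_map_equiv]
    simp only [invSet, Finset.mem_filter, Finset.mem_univ, true_and, inv_simple_mul_apply,
      Equiv.prodCongr_symm, Equiv.prodCongr_apply, Prod.map, hs, Prod.mk.injEq]
    have ha := simple_val j a
    have hb := simple_val j b
    constructor
    · rintro ⟨h1, h2⟩
      by_cases hab : a = lo n j ∧ b = hi n j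
      · exact Or.inl hab
      · refine Or.inr ⟨?_, h2⟩
        simp only [Fin.ext_iff, lo, hi] at hab
        rw [Fin.lt_def] at h1 ⊢
        split_ifs at ha hb <;> omega
    · rintro (⟨rfl, rfl⟩ | ⟨h1, h2⟩)
      · rw [simple_lo, simple_hi]
        exact ⟨lo_lt_hi j, not_desc_iff.1 h⟩
      · refine ⟨?_, h2⟩
        by_cases hab : a = hi n j ∧ b = lo n j
        · rw [hab.1, hab.2, simple_lo, simple_hi] at h2
          exact absurd h2 h
        · simp only [Fin.ext_iff, lo, hi] at hab
          rw [Fin.lt_def] at h1 ⊢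
          split_ifs at ha hb <;> omega
  rw [invNum, key, Finset.card_insert_of_notMem, Finset.card_map, invNum]
  rw [Finset.mem_map_equiv]
  have hs : (simple n j).symm = simple n j := Equiv.symm_swap _ _
  simp only [invSet, Finset.mem_filter, Finset.mem_univ, true_and,
    Equiv.prodCongr_symm, Equiv.prodCongr_apply, Prod.map, hs, simple_lo, simple_hi]
  exact fun h' => lt_asymm h'.1 (lo_lt_hi j)

theorem invNum_simple_mul_of_desc {j : Fin (n - 1)} {w : Equiv.Perm (Fin n)} (h : Desc j w) :
    invNum (simple n j * w) + 1 = invNum w := by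
  have := invNum_simple_mul (j := j) (w := simple n j * w) (by rwa [desc_simple_mul, not_not])
  rw [simple_mul_cancel] at this
  exact this.symm

theorem eq_one_of_not_desc {w : Equiv.Perm (Fin n)} (h : ∀ j, ¬ Desc j w) : w = 1 := by
  cases n with
  | zero => exact Subsingleton.elim _ _
  | succ m =>
    have hm : StrictMono (w⁻¹ : Equiv.Perm (Fin (m + 1))) :=
      Fin.strictMono_iff_lt_succ.2 fun i => not_desc_iff.1 (h i)
    have := Subsingleton.elim (hm.orderIsoOfSurjective _ w⁻¹.surjective) (OrderIso.refl _)
    rw [← inv_eq_one]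
    ext i
    exact congrArg Fin.val (DFunLike.congr_fun this i)

theorem invNum_le_length (l : List (Fin (n - 1))) :
    invNum (l.map (simple n)).prod ≤ l.length := by
  induction l with
  | nil => simp [invNum_one]
  | cons j l ih =>
    rw [List.map_cons, List.prod_cons, List.length_cons]
    by_cases h : Desc j (l.map (simple n)).prod
    · have := invNum_simple_mul_of_desc h
      omega
    · rw [invNum_simple_mul h]
      omega

theorem exists_word (w : Equiv.Perm (Fin n)) :
    ∃ l : List (Fin (n - 1)), (l.map (simple n)).prod = w ∧ l.length = invNum w := by
  induction hk : invNum w using Nat.strong_induction_on generalizing w with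
  | _ k ih =>
    by_cases hw : ∃ j, Desc j w
    · obtain ⟨j, hj⟩ := hw
      have h1 := invNum_simple_mul_of_desc hj
      obtain ⟨l, hl, hlen⟩ := ih _ (by omega) (simple n j * w) rfl
      refine ⟨j :: l, ?_, ?_⟩
      · rw [List.map_cons, List.prod_cons, hl, simple_mul_cancel]
      · rw [List.length_cons]
        omega
    · have hw1 := eq_one_of_not_desc (not_exists.1 hw)
      exact ⟨[], hw1.symm, by rw [← hk, hw1, invNum_one]; rfl⟩

theorem isReducedWord_iff {w : Equiv.Perm (Fin n)} {l : List (Fin (n - 1))} :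
    IsReducedWord n w l ↔ (l.map (simple n)).prod = w ∧ l.length = invNum w := by
  constructor
  · rintro ⟨h1, h2⟩
    obtain ⟨l', hl', hlen⟩ := exists_word w
    have h3 := invNum_le_length l
    rw [h1] at h3
    exact ⟨h1, le_antisymm (hlen ▸ h2 l' hl') h3⟩
  · rintro ⟨h1, h2⟩
    refine ⟨h1, fun l' hl' => ?_⟩
    rw [h2, ← hl']
    exact invNum_le_length l'

theorem exists_reducedWord (w : Equiv.Perm (Fin n)) : ∃ l, IsReducedWord n w l := by
  simpa only [isReducedWord_iff] using exists_word w

theorem isReducedWord_nil_iff {w : Equiv.Perm (Fin n)} : IsReducedWord n w [] ↔ w = 1 := by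
  rw [isReducedWord_iff]
  constructor
  · exact fun h => h.1.symm
  · rintro rfl
    exact ⟨rfl, invNum_one.symm⟩

theorem isReducedWord_cons_iff {w : Equiv.Perm (Fin n)} {j : Fin (n - 1)}
    {l : List (Fin (n - 1))} :
    IsReducedWord n w (j :: l) ↔ Desc j w ∧ IsReducedWord n (simple n j * w) l := by
  simp only [isReducedWord_iff, List.map_cons, List.prod_cons, List.length_cons]
  constructor
  · rintro ⟨rfl, h⟩
    rw [simple_mul_cancel]
    have h3 := invNum_le_length l
    have h4 : Desc j (simple n j * (l.map (simple n)).prod) := by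
      by_contra h4
      have := invNum_simple_mul h4
      rw [simple_mul_cancel] at this
      omega
    have := invNum_simple_mul_of_desc h4
    rw [simple_mul_cancel] at this
    exact ⟨h4, rfl, by omega⟩
  · rintro ⟨hd, h1, h2⟩
    have := invNum_simple_mul_of_desc hd
    exact ⟨by rw [h1, simple_mul_cancel], by omega⟩

theorem IsReducedWord.cons {w : Equiv.Perm (Fin n)} {j : Fin (n - 1)} {l : List (Fin (n - 1))}
    (h : ¬ Desc j w) (hl : IsReducedWord n w l) : IsReducedWord n (simple n j * w) (j :: l) := by
  rw [isReducedWord_cons_iff, desc_simple_mul, simple_mul_cancel]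
  exact ⟨h, hl⟩

theorem prod_map_simple_reverse (l : List (Fin (n - 1))) :
    (l.reverse.map (simple n)).prod = (l.map (simple n)).prod⁻¹ := by
  induction l with
  | nil => simp
  | cons j l ih =>
    have : (simple n j)⁻¹ = simple n j := Equiv.swap_inv _ _
    rw [List.reverse_cons, List.map_append, List.prod_append, ih, List.map_singleton, List.prod_singleton,
      List.map_cons, List.prod_cons, mul_inv_rev, this]

theorem IsReducedWord.reverse {w : Equiv.Perm (Fin n)} {l : List (Fin (n - 1))}
    (h : IsReducedWord n w l) : IsReducedWord n w⁻¹ l.reverse := by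
  refine ⟨by rw [prod_map_simple_reverse, h.1], fun l' hl' => ?_⟩
  rw [List.length_reverse, ← List.length_reverse (as := l')]
  exact h.2 _ (by rw [prod_map_simple_reverse, hl', inv_inv])

theorem isReducedWord_concat {w : Equiv.Perm (Fin n)} {j : Fin (n - 1)} {l : List (Fin (n - 1))}
    (h : IsReducedWord n w (l ++ [j])) :
    Desc j w⁻¹ ∧ IsReducedWord n (w * simple n j) l := by
  have h1 := h.reverse
  rw [List.reverse_append, List.reverse_singleton, List.singleton_append,
    isReducedWord_cons_iff] at h1
  refine ⟨h1.1, ?_⟩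
  have h2 := h1.2.reverse
  have : (simple n j)⁻¹ = simple n j := Equiv.swap_inv _ _
  rwa [List.reverse_reverse, mul_inv_rev, inv_inv, this] at h2

theorem desc_simple_mul_iff {j k : Fin (n - 1)} {w : Equiv.Perm (Fin n)} :
    Desc k (simple n j * w) ↔ w⁻¹ (simple n j (hi n k)) < w⁻¹ (simple n j (lo n k)) := by
  rw [Desc, inv_simple_mul_apply, inv_simple_mul_apply]

theorem simple_comm {j k : Fin (n - 1)} (h : j.1 + 2 ≤ k.1) :
    simple n j * simple n k = simple n k * simple n j := by
  ext a
  simp only [Equiv.Perm.mul_apply, simple_val]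
  split_ifs <;> omega

theorem simple_braid {j k : Fin (n - 1)} (h : k.1 = j.1 + 1) :
    simple n j * simple n k * simple n j = simple n k * simple n j * simple n k := by
  have hk : lo n k = hi n j := Fin.ext h
  have h1 : lo n j ≠ hi n j := (lo_lt_hi j).ne
  have h2 : hi n j ≠ hi n k := hk ▸ (lo_lt_hi k).ne
  have h3 : lo n j ≠ hi n k := Fin.ne_of_val_ne (by simp only [lo, hi]; omega)
  simp only [simple, hk]
  rw [Equiv.swap_mul_swap_mul_swap h1 h3, Equiv.swap_comm (lo n j) (hi n j),
    Equiv.swap_comm (hi n j) (hi n k), Equiv.swap_mul_swap_mul_swap h2.symm h3.symm,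
    Equiv.swap_comm]

theorem lo_eq_hi {j k : Fin (n - 1)} (h : k.1 = j.1 + 1) : lo n k = hi n j := Fin.ext h

theorem simple_hi_of_lt {j k : Fin (n - 1)} (h : j.1 < k.1) : simple n j (hi n k) = hi n k :=
  simple_of_ne j (Fin.ne_of_val_ne (by simp only [lo, hi]; omega))
    (Fin.ne_of_val_ne (by simp only [hi]; omega))

theorem simple_lo_of_lt {j k : Fin (n - 1)} (h : j.1 < k.1) : simple n k (lo n j) = lo n j :=
  simple_of_ne k (Fin.ne_of_val_ne (by simp only [lo]; omega))
    (Fin.ne_of_val_ne (by simp only [lo, hi]; omega))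

theorem simple_lo_of_add_two_le {j k : Fin (n - 1)} (h : j.1 + 2 ≤ k.1) :
    simple n j (lo n k) = lo n k :=
  simple_of_ne j (Fin.ne_of_val_ne (by simp only [lo]; omega))
    (Fin.ne_of_val_ne (by simp only [lo, hi]; omega))

theorem simple_hi_of_add_two_le {j k : Fin (n - 1)} (h : j.1 + 2 ≤ k.1) :
    simple n k (hi n j) = hi n j :=
  simple_of_ne k (Fin.ne_of_val_ne (by simp only [lo, hi]; omega))
    (Fin.ne_of_val_ne (by simp only [hi]; omega))

/-- Two distinct descents at commuting positions. -/
theorem exists_reducedWord_comm {j k : Fin (n - 1)} (h : j.1 + 2 ≤ k.1) {w : Equiv.Perm (Fin n)}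
    (hj : Desc j w) (hk : Desc k w) :
    ∃ c, IsReducedWord n w (j :: k :: c) ∧ IsReducedWord n w (k :: j :: c) := by
  have hbr : simple n k * (simple n j * w) = simple n j * (simple n k * w) := by
    rw [← mul_assoc, ← mul_assoc, simple_comm h]
  obtain ⟨c, hc⟩ := exists_reducedWord (simple n k * (simple n j * w))
  refine ⟨c, ?_, ?_⟩
  · rw [isReducedWord_cons_iff, isReducedWord_cons_iff, desc_simple_mul_iff,
      simple_hi_of_lt (by omega), simple_lo_of_add_two_le h]
    exact ⟨hj, hk, hc⟩
  · rw [isReducedWord_cons_iff, isReducedWord_cons_iff, desc_simple_mul_iff,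
      simple_lo_of_lt (by omega), simple_hi_of_add_two_le h, ← hbr]
    exact ⟨hk, hj, hc⟩

/-- Two distinct descents at adjacent positions. -/
theorem exists_reducedWord_braid {j k : Fin (n - 1)} (h : k.1 = j.1 + 1) {w : Equiv.Perm (Fin n)}
    (hj : Desc j w) (hk : Desc k w) :
    ∃ c, IsReducedWord n w (j :: k :: j :: c) ∧ IsReducedWord n w (k :: j :: k :: c) := by
  have hbr : simple n j * (simple n k * (simple n j * w)) =
      simple n k * (simple n j * (simple n k * w)) := by
    simpa only [mul_assoc] using congrArg (· * w) (simple_braid h)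
  have hlt : j.1 < k.1 := by omega
  have hb : lo n k = hi n j := lo_eq_hi h
  have hs : simple n k (hi n j) = hi n k := by rw [← hb, simple_lo]
  have hs' : simple n j (lo n k) = lo n j := by rw [hb, simple_hi]
  have hk' : w⁻¹ (hi n k) < w⁻¹ (hi n j) := by rwa [← hb]
  obtain ⟨c, hc⟩ := exists_reducedWord (simple n j * (simple n k * (simple n j * w)))
  refine ⟨c, ?_, ?_⟩
  · rw [isReducedWord_cons_iff, isReducedWord_cons_iff, isReducedWord_cons_iff,
      desc_simple_mul_iff, desc_simple_mul_iff, inv_simple_mul_apply, inv_simple_mul_apply, hs,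
      simple_lo_of_lt hlt, simple_hi_of_lt hlt, hb, simple_hi, simple_lo]
    exact ⟨hj, hk'.trans hj, hk', hc⟩
  · rw [isReducedWord_cons_iff, isReducedWord_cons_iff, isReducedWord_cons_iff,
      desc_simple_mul_iff, desc_simple_mul_iff, inv_simple_mul_apply, inv_simple_mul_apply,
      hs, simple_lo_of_lt hlt, simple_hi_of_lt hlt, hs', simple_lo_of_lt hlt, simple_hi, hb, ← hbr]
    exact ⟨hk, hk'.trans hj, hj, hc⟩

/-- Matsumoto's theorem for the symmetric group. -/
theorem prod_map_eq_of_isReducedWord {M : Type*} [Monoid M] {x : Fin (n - 1) → M}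
    (hbraid : ∀ j k : Fin (n - 1), k.1 = j.1 + 1 → x j * x k * x j = x k * x j * x k)
    (hcomm : ∀ j k : Fin (n - 1), j.1 + 2 ≤ k.1 → x j * x k = x k * x j)
    {w : Equiv.Perm (Fin n)} {l l' : List (Fin (n - 1))}
    (h : IsReducedWord n w l) (h' : IsReducedWord n w l') :
    (l.map x).prod = (l'.map x).prod := by
  induction hk : l.length using Nat.strong_induction_on generalizing w l l' with
  | _ m ih =>
    have hlen := (isReducedWord_iff.1 h).2.trans (isReducedWord_iff.1 h').2.symm
    rcases l with _ | ⟨j, l⟩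
    · rw [List.eq_nil_of_length_eq_zero hlen.symm]
    rcases l' with _ | ⟨k, l'⟩
    · simp at hlen
    simp only [List.length_cons, Nat.add_right_cancel_iff] at hlen hk
    have hj := isReducedWord_cons_iff.1 h
    have hk' := isReducedWord_cons_iff.1 h'
    have head : ∀ {i : Fin (n - 1)} {a b : List (Fin (n - 1))}, a.length < m →
        IsReducedWord n w (i :: a) → IsReducedWord n w (i :: b) →
        ((i :: a).map x).prod = ((i :: b).map x).prod := by
      intro i a b hab ha hb
      rw [List.map_cons, List.map_cons, List.prod_cons, List.prod_cons,
        ih _ hab (isReducedWord_cons_iff.1 ha).2 (isReducedWord_cons_iff.1 hb).2 rfl]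
    wlog hjk : j.1 ≤ k.1 generalizing j k l l'
    · exact (this k l' h' (by omega) j l h hlen.symm hk' hj (by omega)).symm
    by_cases e : j = k
    · subst e
      exact head (by omega) h h'
    have e' : j.1 ≠ k.1 := fun h => e (Fin.ext h)
    by_cases hadj : k.1 = j.1 + 1
    · obtain ⟨c, r1, r2⟩ := exists_reducedWord_braid hadj hj.1 hk'.1
      rw [head (by omega) h r1, head (by omega) h' r2]
      simp only [List.map_cons, List.prod_cons, ← mul_assoc]
      rw [hbraid j k hadj]
    · have hfar : j.1 + 2 ≤ k.1 := by omega
      obtain ⟨c, r1, r2⟩ := exists_reducedWord_comm hfar hj.1 hk'.1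
      rw [head (by omega) h r1, head (by omega) h' r2]
      simp only [List.map_cons, List.prod_cons, ← mul_assoc]
      rw [hcomm j k hfar]

end Words

section Trace

variable {R : Type*} [CommRing R] {n r : ℕ} {H : Type*} [Ring H] [Algebra R H]
  {ψ : ((Fin n → Fin r) → R) →ₐ[R] H} {x : Fin (n - 1) → H} {c : R}

/-- The function `c · 1_{k_i < k_j}`. -/
def ltFun (r : ℕ) (c : R) (i j : Fin n) : (Fin n → Fin r) → R := fun k => if k i < k j then c else 0

/-- The function `c · 1_{k_i = k_j}`. -/
def eqFun (r : ℕ) (c : R) (i j : Fin n) : (Fin n → Fin r) → R := fun k => if k i = k j then c else 0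

theorem ltFun_mul_self (i j : Fin n) : ltFun r c i j * ltFun r c i j = c • ltFun r c i j := by
  funext k
  simp only [ltFun, Pi.mul_apply, Pi.smul_apply, smul_eq_mul]
  split_ifs <;> ring

theorem ltFun_add_ltFun_add_eqFun (i j : Fin n) :
    ltFun r c i j + ltFun r c j i + eqFun r c i j = c • 1 := by
  funext k
  simp only [ltFun, eqFun, Pi.add_apply, Pi.smul_apply, Pi.one_apply, smul_eq_mul, mul_one]
  rcases lt_trichotomy (k i) (k j) with h | h | h
  · simp [h, h.not_gt, h.ne]
  · simp [h]
  · simp [h, h.not_gt, h.ne']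

theorem ltFun_mul_ltFun_right (i j k : Fin n) :
    ltFun r c i k * eqFun r c i j + ltFun r c i k * ltFun r c j i + ltFun r c i j * ltFun r c j k =
      ltFun r c j k * ltFun r c i k := by
  funext m
  simp only [ltFun, eqFun, Pi.add_apply, Pi.mul_apply]
  split_ifs <;> first | (exfalso; order) | ring

theorem ltFun_mul_ltFun_left (i j k : Fin n) :
    ltFun r c i k * eqFun r c j k + ltFun r c i k * ltFun r c k j + ltFun r c j k * ltFun r c i j =
      ltFun r c i j * ltFun r c i k := by
  funext m
  simp only [ltFun, eqFun, Pi.add_apply, Pi.mul_apply]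
  split_ifs <;> first | (exfalso; order) | ring

theorem ltFun_braid (i j k : Fin n) : ltFun r c i j * ltFun r c j k * ltFun r c i j =
    ltFun r c j k * ltFun r c i j * ltFun r c j k := by
  funext m
  simp only [ltFun, Pi.mul_apply]
  split_ifs <;> ring

theorem mul_ltFun
    (hx : ∀ j f, x j * ψ f = ψ (fun k => f (k ∘ simple n j)) * x j) (j : Fin (n - 1)) (a b : Fin n) :
    x j * ψ (ltFun r c a b) = ψ (ltFun r c (simple n j a) (simple n j b)) * x j :=
  hx j _

/-- The quadratic relation for the `g_j` follows from that for the `T_j`. -/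
theorem mul_self_of_quadratic
    (hx : ∀ j f, x j * ψ f = ψ (fun k => f (k ∘ simple n j)) * x j) {j : Fin (n - 1)}
    (hT : (x j + ψ (ltFun r c (lo n j) (hi n j))) * (x j + ψ (ltFun r c (lo n j) (hi n j))) =
      c • (x j + ψ (ltFun r c (lo n j) (hi n j))) + 1) :
    x j * x j = 1 + ψ (eqFun r c (lo n j) (hi n j)) * x j := by
  have h1 := mul_ltFun (c := c) hx j (lo n j) (hi n j)
  rw [simple_lo, simple_hi] at h1
  have h2 : ψ (ltFun r c (lo n j) (hi n j)) * ψ (ltFun r c (lo n j) (hi n j)) =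
      c • ψ (ltFun r c (lo n j) (hi n j)) := by
    rw [← map_mul, ltFun_mul_self, map_smul]
  have h3 : ψ (eqFun r c (lo n j) (hi n j)) =
      c • 1 - ψ (ltFun r c (lo n j) (hi n j)) - ψ (ltFun r c (hi n j) (lo n j)) := by
    rw [← map_one ψ, ← map_smul, ← ltFun_add_ltFun_add_eqFun (lo n j) (hi n j), map_add, map_add]
    abel
  rw [mul_add, add_mul, add_mul, h1, h2, smul_add] at hT
  rw [h3, sub_mul, sub_mul, smul_mul_assoc, one_mul]
  rw [← sub_eq_zero] at hT ⊢
  rw [← hT]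
  abel

/-- The braid relations for the `g_j` follow from those for the `T_j`. -/
theorem braid_of_braid
    (hx : ∀ j f, x j * ψ f = ψ (fun k => f (k ∘ simple n j)) * x j)
    (hx2 : ∀ j, x j * x j = 1 + ψ (eqFun r c (lo n j) (hi n j)) * x j)
    {j k : Fin (n - 1)} (hjk : k.1 = j.1 + 1)
    (hT : (x j + ψ (ltFun r c (lo n j) (hi n j))) * (x k + ψ (ltFun r c (lo n k) (hi n k))) *
        (x j + ψ (ltFun r c (lo n j) (hi n j))) =
      (x k + ψ (ltFun r c (lo n k) (hi n k))) * (x j + ψ (ltFun r c (lo n j) (hi n j))) *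
        (x k + ψ (ltFun r c (lo n k) (hi n k)))) :
    x j * x k * x j = x k * x j * x k := by
  have hlt : j.1 < k.1 := by omega
  have hb : lo n k = hi n j := lo_eq_hi hjk
  have hs : simple n k (hi n j) = hi n k := by rw [← hb, simple_lo]
  have hs' : simple n k (hi n k) = hi n j := by rw [← hb, simple_hi]
  have hj2 := hx2 j
  have hk2 := hx2 k
  rw [hb] at hT hk2
  have ha := simple_lo_of_lt hlt
  have hc := simple_hi_of_lt hlt
  have ja := simple_lo j
  have jb := simple_hi j
  generalize lo n j = α at *
  generalize hi n j = β at *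
  generalize hi n k = γ at *
  have e : ∀ a b, x j * ψ (ltFun r c a b) = ψ (ltFun r c (simple n j a) (simple n j b)) * x j :=
    mul_ltFun hx j
  have e' : ∀ a b, x k * ψ (ltFun r c a b) = ψ (ltFun r c (simple n k a) (simple n k b)) * x k :=
    mul_ltFun hx k
  have i1 := congrArg ψ (ltFun_mul_ltFun_right (r := r) (c := c) α β γ)
  have i2 := congrArg ψ (ltFun_mul_ltFun_left (r := r) (c := c) α β γ)
  have i3 := congrArg ψ (ltFun_braid (r := r) (c := c) α β γ)
  simp only [map_add, map_mul] at i1 i2 i3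
  have t1 : x j * x k * ψ (ltFun r c α β) = ψ (ltFun r c β γ) * (x j * x k) := by
    rw [mul_assoc, e', ← mul_assoc, e, mul_assoc, ha, hs, ja, hc]
  have t2 : x k * x j * ψ (ltFun r c β γ) = ψ (ltFun r c α β) * (x k * x j) := by
    rw [mul_assoc, e, ← mul_assoc, e', mul_assoc, jb, hc, ha, hs']
  have t3 : x j * ψ (ltFun r c β γ) * x j =
      ψ (ltFun r c α γ) + ψ (ltFun r c α γ) * ψ (eqFun r c α β) * x j := by
    rw [e, mul_assoc, hj2, jb, hc, mul_add, mul_one, mul_assoc]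
  have t4 : x k * ψ (ltFun r c α β) * x k =
      ψ (ltFun r c α γ) + ψ (ltFun r c α γ) * ψ (eqFun r c β γ) * x k := by
    rw [e', mul_assoc, hk2, ha, hs, mul_add, mul_one, mul_assoc]
  have t5 : x j * ψ (ltFun r c β γ) * ψ (ltFun r c α β) =
      ψ (ltFun r c α γ) * ψ (ltFun r c β α) * x j := by
    rw [e, mul_assoc, e, ← mul_assoc, jb, hc, ja]
  have t6 : x k * ψ (ltFun r c α β) * ψ (ltFun r c β γ) =
      ψ (ltFun r c α γ) * ψ (ltFun r c γ β) * x k := by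
    rw [e', mul_assoc, e', ← mul_assoc, ha, hs, hs']
  have t7 : ψ (ltFun r c α β) * x k * ψ (ltFun r c α β) =
      ψ (ltFun r c α β) * ψ (ltFun r c α γ) * x k := by
    rw [mul_assoc, e', ← mul_assoc, ha, hs]
  have t8 : ψ (ltFun r c β γ) * x j * ψ (ltFun r c β γ) =
      ψ (ltFun r c β γ) * ψ (ltFun r c α γ) * x j := by
    rw [mul_assoc, e, ← mul_assoc, jb, hc]
  simp only [add_mul, mul_add, t1, t2, t3, t4, t5, t6, t7, t8, i3] at hT
  rw [← i1, ← i2] at hT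
  simp only [add_mul, mul_assoc] at hT ⊢
  rw [← sub_eq_zero] at hT ⊢
  rw [← hT]
  abel

theorem comm_of_comm
    (hx : ∀ j f, x j * ψ f = ψ (fun k => f (k ∘ simple n j)) * x j)
    {j k : Fin (n - 1)} (hjk : j.1 + 2 ≤ k.1)
    (hT : (x j + ψ (ltFun r c (lo n j) (hi n j))) * (x k + ψ (ltFun r c (lo n k) (hi n k))) =
      (x k + ψ (ltFun r c (lo n k) (hi n k))) * (x j + ψ (ltFun r c (lo n j) (hi n j)))) :
    x j * x k = x k * x j := by
  have h1 := mul_ltFun (c := c) hx j (lo n k) (hi n k)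
  have h2 := mul_ltFun (c := c) hx k (lo n j) (hi n j)
  rw [simple_lo_of_add_two_le hjk, simple_hi_of_lt (by omega)] at h1
  rw [simple_hi_of_add_two_le hjk, simple_lo_of_lt (by omega)] at h2
  have h3 : ψ (ltFun r c (lo n j) (hi n j)) * ψ (ltFun r c (lo n k) (hi n k)) =
      ψ (ltFun r c (lo n k) (hi n k)) * ψ (ltFun r c (lo n j) (hi n j)) := by
    rw [← map_mul, mul_comm, map_mul]
  simp only [add_mul, mul_add, h1, h2, h3] at hT
  rw [← sub_eq_zero] at hT ⊢
  rw [← hT]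
  abel

theorem exists_prod_mul_eq
    (hx : ∀ j f, x j * ψ f = ψ (fun k => f (k ∘ simple n j)) * x j) (l : List (Fin (n - 1)))
    (f : (Fin n → Fin r) → R) : ∃ f', (l.map x).prod * ψ f = ψ f' * (l.map x).prod := by
  induction l with
  | nil => exact ⟨f, by simp⟩
  | cons j l ih =>
    obtain ⟨f', hf'⟩ := ih
    exact ⟨_, by rw [List.map_cons, List.prod_cons, mul_assoc, hf', ← mul_assoc, hx, mul_assoc]⟩

/-- The trace form on products of standard basis elements. -/
theorem trace_mul_prod_mul_prod
    (hx : ∀ j f, x j * ψ f = ψ (fun k => f (k ∘ simple n j)) * x j)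
    (hx2 : ∀ j, x j * x j = 1 + ψ (eqFun r c (lo n j) (hi n j)) * x j)
    (hbraid : ∀ j k : Fin (n - 1), k.1 = j.1 + 1 → x j * x k * x j = x k * x j * x k)
    (hcomm : ∀ j k : Fin (n - 1), j.1 + 2 ≤ k.1 → x j * x k = x k * x j)
    {τ : H →ₗ[R] R}
    (hτ : ∀ f (w : Equiv.Perm (Fin n)) (l : List (Fin (n - 1))), IsReducedWord n w l →
      τ (ψ f * (l.map x).prod) = if w = 1 then τ (ψ f) else 0)
    {w w' : Equiv.Perm (Fin n)} {l l' : List (Fin (n - 1))}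
    (hl : IsReducedWord n w l) (hl' : IsReducedWord n w' l') (f : (Fin n → Fin r) → R) :
    τ (ψ f * (l.map x).prod * (l'.map x).prod) = if w' = w⁻¹ then τ (ψ f) else 0 := by
  induction l using List.reverseRecOn generalizing w w' l' f with
  | nil =>
    rw [isReducedWord_nil_iff] at hl
    subst hl
    simpa using hτ f w' l' hl'
  | append_singleton l j ih =>
    obtain ⟨hd, hl0⟩ := isReducedWord_concat hl
    have hinv : (w * simple n j)⁻¹ = simple n j * w⁻¹ := by
      rw [mul_inv_rev]
      exact congrArg (· * w⁻¹) (Equiv.swap_inv _ _)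
    have hiff : simple n j * w' = (w * simple n j)⁻¹ ↔ w' = w⁻¹ := by
      rw [hinv, mul_right_inj]
    by_cases hdw : Desc j w'
    · obtain ⟨m, hm⟩ := exists_reducedWord (simple n j * w')
      have hm' : IsReducedWord n w' (j :: m) := isReducedWord_cons_iff.2 ⟨hdw, hm⟩
      have hprod := prod_map_eq_of_isReducedWord hbraid hcomm hl' hm'
      obtain ⟨f', hf'⟩ := exists_prod_mul_eq hx l (eqFun r c (lo n j) (hi n j))
      have hne : w' ≠ (w * simple n j)⁻¹ := by
        intro h
        rw [h, hinv] at hdw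
        exact desc_simple_mul.1 hdw hd
      have expand : ψ f * ((l ++ [j]).map x).prod * (l'.map x).prod =
          ψ f * (l.map x).prod * (m.map x).prod +
            ψ (f * f') * (l.map x).prod * (l'.map x).prod := by
        calc ψ f * ((l ++ [j]).map x).prod * (l'.map x).prod
            = ψ f * (l.map x).prod * (x j * x j) * (m.map x).prod := by
              rw [hprod]
              simp [mul_assoc]
          _ = ψ f * (l.map x).prod * (m.map x).prod + ψ f *
              ((l.map x).prod * ψ (eqFun r c (lo n j) (hi n j))) * (x j * (m.map x).prod) := by
              rw [hx2]
              noncomm_ring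
          _ = _ := by
              rw [hf', hprod, map_mul, List.map_cons, List.prod_cons]
              noncomm_ring
      rw [expand, map_add, ih hl0 hm, ih hl0 hl', if_neg hne, add_zero]
      simp only [hiff]
    · have h := ih hl0 (IsReducedWord.cons hdw hl') f
      simp only [hiff] at h
      rw [← h]
      simp [mul_assoc]

end Trace

section Lagrange

variable {R : Type*} [CommRing R] {r : ℕ} {u : Fin r → R}

theorem X_sub_C_mul_bpoly (c : Fin r) : ∃ a : R,
    (X - C (u c)) * bpoly R r u c = a • ∏ j : Fin r, (X - C (u j)) := by
  refine ⟨∏ j ∈ Finset.univ.erase c, Ring.inverse (u c - u j), ?_⟩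
  rw [bpoly, Finset.filter_ne', Finset.prod_smul, mul_smul_comm,
    Finset.mul_prod_erase _ (fun j => X - C (u j)) (Finset.mem_univ c)]

theorem natDegree_bpoly_lt (c : Fin r) : (bpoly R r u c).natDegree < r := by
  have h : (bpoly R r u c).natDegree ≤ ∑ j ∈ Finset.univ.erase c, 1 := by
    rw [bpoly, Finset.filter_ne']
    refine (natDegree_prod_le _ _).trans (Finset.sum_le_sum fun j _ => ?_)
    exact (natDegree_smul_le _ _).trans (natDegree_X_sub_C_le _)
  rw [Finset.sum_const, Finset.card_erase_of_mem (Finset.mem_univ c), Finset.card_univ,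
    Fintype.card_fin, smul_eq_mul, mul_one] at h
  have := c.pos
  omega

theorem eval_bpoly (hu : ∀ i j, i ≠ j → IsUnit (u i - u j)) (c c' : Fin r) :
    (bpoly R r u c).eval (u c') = if c' = c then 1 else 0 := by
  rw [bpoly, eval_prod, Finset.filter_ne']
  split_ifs with h
  · subst h
    refine Finset.prod_eq_one fun j hj => ?_
    rw [eval_smul, eval_sub, eval_X, eval_C, smul_eq_mul,
      Ring.inverse_mul_cancel _ (hu _ _ (Finset.ne_of_mem_erase hj).symm)]
  · refine Finset.prod_eq_zero (Finset.mem_erase.2 ⟨h, Finset.mem_univ c'⟩) ?_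
    simp

theorem sum_bpoly [IsDomain R] (hr : 1 ≤ r) (hu : ∀ i j, i ≠ j → IsUnit (u i - u j)) :
    ∑ c, bpoly R r u c = 1 := by
  have hinj : Set.InjOn u (Finset.univ : Finset (Fin r)) := by
    intro i _ j _ hij
    by_contra hne
    exact (hu i j hne).ne_zero (sub_eq_zero.2 hij)
  refine Polynomial.eq_of_degrees_lt_of_eval_index_eq _ hinj ?_ ?_ fun i _ => ?_
  · rw [Finset.card_univ, Fintype.card_fin]
    refine (degree_sum_le _ _).trans_lt ((Finset.sup_lt_iff (WithBot.bot_lt_coe r)).2 ?_)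
    exact fun c _ => degree_le_natDegree.trans_lt (Nat.cast_lt.2 (natDegree_bpoly_lt c))
  · rw [Finset.card_univ, Fintype.card_fin, degree_one]
    exact_mod_cast hr
  · simp [eval_finsetSum, eval_bpoly hu]

end Lagrange

section Idempotents

open scoped IsMulCommutative in
theorem exists_mvPolynomial_algHom {R ι A : Type*} [CommRing R] [Ring A] [Algebra R A]
    (t : ι → A) (ht : ∀ i j, t i * t j = t j * t i) :
    ∃ φ : MvPolynomial ι R →ₐ[R] A, ∀ i, φ (MvPolynomial.X i) = t i := by
  have : IsMulCommutative (Algebra.adjoin R (Set.range t)) :=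
    Algebra.isMulCommutative_adjoin R (by rintro _ ⟨i, rfl⟩ _ ⟨j, rfl⟩; exact ht i j)
  refine ⟨(Algebra.adjoin R (Set.range t)).val.comp (MvPolynomial.aeval fun i =>
    (⟨t i, Algebra.subset_adjoin ⟨i, rfl⟩⟩ : Algebra.adjoin R (Set.range t))), fun i => ?_⟩
  simp

variable {R : Type*} [CommRing R] {n r : ℕ} {u : Fin r → R}

/-- The polynomial representing the idempotent `b_k`. -/
noncomputable def bMvPoly (u : Fin r → R) (k : Fin n → Fin r) : MvPolynomial (Fin n) R :=
  ∏ i, aeval (MvPolynomial.X i) (bpoly R r u (k i))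

theorem sum_bMvPoly [IsDomain R] (hr : 1 ≤ r) (hu : ∀ i j, i ≠ j → IsUnit (u i - u j)) :
    ∑ k : Fin n → Fin r, bMvPoly u k = 1 := by
  simp only [bMvPoly]
  rw [← Fintype.prod_sum (fun (i : Fin n) (c : Fin r) =>
    aeval (MvPolynomial.X i : MvPolynomial (Fin n) R) (bpoly R r u c))]
  refine Finset.prod_eq_one fun i _ => ?_
  rw [← map_sum, sum_bpoly hr hu, map_one]

theorem eval_bMvPoly (hu : ∀ i j, i ≠ j → IsUnit (u i - u j)) (k k' : Fin n → Fin r) :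
    MvPolynomial.aeval (u ∘ k') (bMvPoly u k) = if k' = k then (1 : R) else 0 := by
  have h : ∀ i, MvPolynomial.aeval (u ∘ k')
      (aeval (MvPolynomial.X i : MvPolynomial (Fin n) R) (bpoly R r u (k i))) =
        if k' i = k i then (1 : R) else 0 := by
    intro i
    rw [← Polynomial.aeval_algHom_apply, MvPolynomial.aeval_X, Polynomial.coe_aeval_eq_eval,
      Function.comp_apply, eval_bpoly hu]
  rw [bMvPoly, map_prod, Finset.prod_congr rfl fun i _ => h i, Fintype.prod_ite_zero]
  simp [funext_iff]

theorem bMvPoly_mem_span (k : Fin n → Fin r) : bMvPoly u k ∈ Submodule.span R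
    {p | ∃ c : Fin n → ℕ, (∀ i, c i ≤ r - 1) ∧ p = ∏ i, MvPolynomial.X i ^ c i} := by
  have h : ∀ i, aeval (MvPolynomial.X i : MvPolynomial (Fin n) R) (bpoly R r u (k i)) =
      ∑ m : Fin r, (bpoly R r u (k i)).coeff m • MvPolynomial.X i ^ (m : ℕ) := by
    intro i
    rw [Polynomial.aeval_eq_sum_range' (natDegree_bpoly_lt _), Finset.sum_range]
  rw [bMvPoly, Finset.prod_congr rfl fun i _ => h i, Fintype.prod_sum]
  refine Submodule.sum_mem _ fun c _ => ?_
  rw [Finset.prod_smul]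
  refine Submodule.smul_mem _ _ (Submodule.subset_span ⟨fun i => c i, fun i => ?_, rfl⟩)
  exact Nat.le_sub_one_of_lt (c i).2

variable {A : Type*} [Ring A] [Algebra R A] {φ : MvPolynomial (Fin n) R →ₐ[R] A}

theorem map_mul_bMvPoly
    (hφ : ∀ i, aeval (φ (MvPolynomial.X i)) (∏ c : Fin r, (X - C (u c))) = 0)
    (p : MvPolynomial (Fin n) R) (k : Fin n → Fin r) :
    φ p * φ (bMvPoly u k) = MvPolynomial.aeval (u ∘ k) p • φ (bMvPoly u k) := by
  have hX : ∀ i, φ (MvPolynomial.X i) * φ (bMvPoly u k) = u (k i) • φ (bMvPoly u k) := by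
    intro i
    obtain ⟨a, ha⟩ := X_sub_C_mul_bpoly (u := u) (k i)
    have h1 : φ (aeval (MvPolynomial.X i) ((X - C (u (k i))) * bpoly R r u (k i))) = 0 := by
      rw [ha, map_smul, map_smul, ← Polynomial.aeval_algHom_apply, hφ, smul_zero]
    rw [← sub_eq_zero, ← map_mul, ← map_smul, ← map_sub]
    have h2 : MvPolynomial.X i * bMvPoly u k - u (k i) • bMvPoly u k =
        aeval (MvPolynomial.X i) ((X - C (u (k i))) * bpoly R r u (k i)) *
          ∏ j ∈ Finset.univ.erase i, aeval (MvPolynomial.X j) (bpoly R r u (k j)) := by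
      rw [bMvPoly, ← Finset.mul_prod_erase _ _ (Finset.mem_univ i)]
      simp only [map_mul, map_sub, aeval_X, aeval_C, Algebra.smul_def]
      ring
    rw [h2, map_mul, h1, zero_mul]
  induction p using MvPolynomial.induction_on with
  | C a => simp [← MvPolynomial.algebraMap_eq, Algebra.smul_def]
  | add p q hp hq => rw [map_add, add_mul, hp, hq, map_add, add_smul]
  | mul_X p i hp =>
    rw [map_mul, mul_assoc, hX, mul_smul_comm, hp, map_mul, MvPolynomial.aeval_X, smul_smul,
      mul_comm]
    rfl

/-- Commuting elements annihilated by `∏ (X - u_c)` define a representation of the algebra of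
functions on the set of multi-indices. -/
theorem exists_function_algHom [IsDomain R] (hr : 1 ≤ r)
    (hu : ∀ i j, i ≠ j → IsUnit (u i - u j))
    (t : Fin n → A) (ht : ∀ i j, t i * t j = t j * t i)
    (ht' : ∀ i, aeval (t i) (∏ c : Fin r, (X - C (u c))) = 0) :
    ∃ ψ : ((Fin n → Fin r) → R) →ₐ[R] A,
      (∀ i, ψ (fun k => u (k i)) = t i) ∧
      (∀ f, ψ f = ∑ k, f k • (List.ofFn fun i => aeval (t i) (bpoly R r u (k i))).prod) ∧
      ∀ f, ψ f ∈ Submodule.span R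
        {a | ∃ c : Fin n → ℕ, (∀ i, c i ≤ r - 1) ∧ a = (List.ofFn fun i => t i ^ c i).prod} := by
  obtain ⟨φ, hφ⟩ := exists_mvPolynomial_algHom (R := R) t ht
  have hb : ∀ k : Fin n → Fin r, (List.ofFn fun i => aeval (t i) (bpoly R r u (k i))).prod =
      φ (bMvPoly u k) := by
    intro k
    rw [bMvPoly, ← List.prod_ofFn, map_list_prod, List.map_ofFn]
    congr 2
    funext i
    rw [Function.comp_apply, ← Polynomial.aeval_algHom_apply, hφ]
  have hsmul := map_mul_bMvPoly (φ := φ) (u := u) (by simpa only [hφ] using ht')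
  have heval : ∀ p, φ p = ∑ k : Fin n → Fin r,
      MvPolynomial.aeval (u ∘ k) p • φ (bMvPoly u k) := by
    intro p
    rw [← Finset.sum_congr rfl fun k _ => hsmul p k, ← Finset.mul_sum, ← map_sum,
      sum_bMvPoly hr hu, map_one, mul_one]
  let L : ((Fin n → Fin r) → R) →ₗ[R] A := Fintype.linearCombination R fun k => φ (bMvPoly u k)
  have hL : ∀ f, L f = ∑ k, f k • φ (bMvPoly u k) := fun f => rfl
  have hLp : ∀ p : MvPolynomial (Fin n) R, L (fun k => MvPolynomial.aeval (u ∘ k) p) = φ p :=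
    fun p => (heval p).symm
  have hLmul : ∀ f k, L f * φ (bMvPoly u k) = f k • φ (bMvPoly u k) := by
    intro f k
    have : L f = φ (∑ k', f k' • bMvPoly u k') := by simp only [hL, map_sum, map_smul]
    rw [this, hsmul, map_sum]
    simp [eval_bMvPoly hu]
  refine ⟨AlgHom.ofLinearMap L ?_ ?_, fun i => ?_, fun f => ?_, fun f => ?_⟩
  · rw [← map_one φ, ← hLp]
    simp only [map_one]
    rfl
  · intro f g
    rw [hL g, Finset.mul_sum, hL]
    refine Finset.sum_congr rfl fun k _ => ?_
    rw [mul_smul_comm, hLmul, smul_smul, Pi.mul_apply, mul_comm]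
  · rw [AlgHom.ofLinearMap_apply, ← hφ, ← hLp]
    simp only [MvPolynomial.aeval_X, Function.comp_apply]
  · simp only [hb]
    exact hL f
  · rw [AlgHom.ofLinearMap_apply, hL]
    refine Submodule.sum_mem _ fun k _ => Submodule.smul_mem _ _ ?_
    have h := Submodule.mem_map_of_mem (f := φ.toLinearMap) (bMvPoly_mem_span (u := u) k)
    rw [Submodule.map_span] at h
    refine Submodule.span_mono ?_ h
    rintro _ ⟨_, ⟨c, hc, rfl⟩, rfl⟩
    refine ⟨c, hc, ?_⟩
    rw [AlgHom.toLinearMap_apply, ← List.prod_ofFn, map_list_prod, List.map_ofFn]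
    congr 2
    funext i
    rw [Function.comp_apply, map_pow, hφ]

theorem exists_aeval_eq (hu : ∀ i j, i ≠ j → IsUnit (u i - u j)) (f : (Fin n → Fin r) → R) :
    ∃ p : MvPolynomial (Fin n) R, f = fun k => MvPolynomial.aeval (u ∘ k) p := by
  refine ⟨∑ k, f k • bMvPoly u k, ?_⟩
  funext k
  simp [map_sum, eval_bMvPoly hu]

theorem mul_map_eq_of_coord (hu : ∀ i j, i ≠ j → IsUnit (u i - u j))
    {ψ : ((Fin n → Fin r) → R) →ₐ[R] A} {x : A} {σ : Fin n → Fin n}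
    (h : ∀ i, x * ψ (fun k => u (k i)) = ψ (fun k => u (k (σ i))) * x)
    (f : (Fin n → Fin r) → R) : x * ψ f = ψ (fun k => f (k ∘ σ)) * x := by
  obtain ⟨p, rfl⟩ := exists_aeval_eq hu f
  induction p using MvPolynomial.induction_on with
  | C a =>
    have h1 : (fun _ => a : (Fin n → Fin r) → R) = algebraMap R _ a := rfl
    simp only [← MvPolynomial.algebraMap_eq, AlgHom.commutes, Algebra.algebraMap_self_apply]
    rw [h1, AlgHom.commutes, Algebra.commutes]
  | add p q hp hq =>
    simp only [map_add]
    erw [map_add ψ, map_add ψ, mul_add, add_mul, hp, hq]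
  | mul_X p i hp =>
    simp only [map_mul, MvPolynomial.aeval_X]
    erw [map_mul ψ, map_mul ψ, ← mul_assoc, hp, mul_assoc, h, mul_assoc]
    rfl

end Idempotents

section Hnr

variable {R : Type*} [CommRing R] {n r : ℕ} {q Δ : Rˣ} {u : Fin r → R} {F : Fin r → R[X]}

theorem isUnit_sub_of_prod
    (hΔ : (Δ : R) = ∏ i : Fin r, ∏ j ∈ Finset.univ.filter (fun j => j < i), (u i - u j))
    (i j : Fin r) (hij : i ≠ j) : IsUnit (u i - u j) := by
  have h : ∀ i j : Fin r, j < i → IsUnit (u i - u j) := by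
    intro i j hij
    refine isUnit_of_dvd_unit ?_ Δ.isUnit
    rw [hΔ]
    exact (Finset.dvd_prod_of_mem _ (Finset.mem_filter.2 ⟨Finset.mem_univ j, hij⟩)).trans
      (Finset.dvd_prod_of_mem (fun i => ∏ j ∈ Finset.univ.filter (fun j => j < i), (u i - u j))
        (Finset.mem_univ i))
  rcases lt_or_gt_of_ne hij with h' | h'
  · rw [← neg_sub]
    exact (h j i h').neg
  · exact h i j h'

theorem pim_eq_of_rel {a b : FA R n} (h : Rel R n r q Δ u F a b) :
    pim R n r q Δ u F a = pim R n r q Δ u F b :=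
  RingQuot.mkAlgHom_rel R h

theorem tt_comm (i j : Fin n) : tt R n r q Δ u F i * tt R n r q Δ u F j =
    tt R n r q Δ u F j * tt R n r q Δ u F i := by
  simpa only [map_mul, tt, TT] using pim_eq_of_rel (Rel.tcomm i j)

theorem aeval_tt_prod (i : Fin n) :
    aeval (tt R n r q Δ u F i) (∏ c : Fin r, (X - C (u c))) = 0 := by
  rw [tt, Polynomial.aeval_algHom_apply, pim_eq_of_rel (Rel.tord i), map_zero]

theorem mul_self_of_factor {A : Type*} [Ring A] [Algebra R A] {a : A}
    (h : (a - algebraMap R A q) * (a + algebraMap R A ((q⁻¹ : Rˣ) : R)) = 0) :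
    a * a = ((q : R) - ((q⁻¹ : Rˣ) : R)) • a + 1 := by
  rw [sub_mul, mul_add, mul_add, ← map_mul, Units.mul_inv, map_one, ← Algebra.commutes,
    ← Algebra.smul_def, ← Algebra.smul_def] at h
  rw [sub_smul, ← sub_eq_zero, ← h]
  abel

theorem TT_mul_self (j : Fin (n - 1)) : TT R n r q Δ u F j * TT R n r q Δ u F j =
    ((q : R) - ((q⁻¹ : Rˣ) : R)) • TT R n r q Δ u F j + 1 := by
  have h := pim_eq_of_rel (q := q) (Δ := Δ) (u := u) (F := F) (Rel.quad j)
  rw [map_mul, map_sub, map_add, AlgHom.commutes, AlgHom.commutes, map_zero] at h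
  exact mul_self_of_factor h

theorem TT_braid {j k : Fin (n - 1)} (h : k.1 = j.1 + 1) :
    TT R n r q Δ u F j * TT R n r q Δ u F k * TT R n r q Δ u F j =
      TT R n r q Δ u F k * TT R n r q Δ u F j * TT R n r q Δ u F k := by
  simpa only [map_mul, tt, TT] using pim_eq_of_rel (Rel.braid j k h)

theorem TT_comm {j k : Fin (n - 1)} (h : j.1 + 2 ≤ k.1) :
    TT R n r q Δ u F j * TT R n r q Δ u F k = TT R n r q Δ u F k * TT R n r q Δ u F j := by
  simpa only [map_mul, tt, TT] using pim_eq_of_rel (Rel.Tcomm j k (Or.inl h))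

theorem TT_mul_tt_of_ne (j : Fin (n - 1)) {i : Fin n} (h1 : i ≠ lo n j) (h2 : i ≠ hi n j) :
    TT R n r q Δ u F j * tt R n r q Δ u F i = tt R n r q Δ u F i * TT R n r q Δ u F j := by
  simpa only [map_mul, tt, TT] using pim_eq_of_rel (Rel.Tt j i h1 h2)

theorem TT_mul_tt_hi (j : Fin (n - 1)) :
    TT R n r q Δ u F j * tt R n r q Δ u F (hi n j) =
      tt R n r q Δ u F (lo n j) * TT R n r q Δ u F j +
        pim R n r q Δ u F (Bel R n r q Δ u F j) := by
  simpa only [map_mul, map_add, tt, TT] using pim_eq_of_rel (Rel.Thi j)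

theorem TT_mul_tt_lo (j : Fin (n - 1)) :
    TT R n r q Δ u F j * tt R n r q Δ u F (lo n j) =
      tt R n r q Δ u F (hi n j) * TT R n r q Δ u F j -
        pim R n r q Δ u F (Bel R n r q Δ u F j) := by
  simpa only [map_mul, map_sub, tt, TT] using pim_eq_of_rel (Rel.Tlo j)

variable {ψ : ((Fin n → Fin r) → R) →ₐ[R] Hnr R n r q Δ u F}

theorem aeval_tt_eq (hψ : ∀ i, ψ (fun k => u (k i)) = tt R n r q Δ u F i) (i : Fin n)
    (p : R[X]) : aeval (tt R n r q Δ u F i) p = ψ (fun k => p.eval (u (k i))) := by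
  rw [← hψ, Polynomial.aeval_algHom_apply]
  congr 1
  funext k
  exact (Polynomial.aeval_algHom_apply (Pi.evalAlgHom R (fun _ => R) k) _ p).symm

theorem pim_Bel (hFeval : ∀ c c' : Fin r, (F c).eval (u c') = if c' = c then (Δ : R) else 0)
    (hψ : ∀ i, ψ (fun k => u (k i)) = tt R n r q Δ u F i) (j : Fin (n - 1)) :
    pim R n r q Δ u F (Bel R n r q Δ u F j) =
      ψ (ltFun r ((q : R) - ((q⁻¹ : Rˣ) : R)) (lo n j) (hi n j)) *
        (tt R n r q Δ u F (hi n j) - tt R n r q Δ u F (lo n j)) := by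
  have h : ∀ i p, pim R n r q Δ u F (aeval (tf R n i) p) = ψ (fun k => p.eval (u (k i))) := by
    intro i p
    rw [← aeval_tt_eq hψ, tt, Polynomial.aeval_algHom_apply]
  simp only [Bel, map_sum, map_smul, map_mul, h, ← hψ]
  simp only [← map_mul, ← map_smul, ← map_sum, ← map_sub]
  congr 1
  funext k
  simp only [Finset.sum_apply, Pi.smul_apply, Pi.mul_apply, Pi.sub_apply, smul_eq_mul, hFeval,
    ltFun]
  rw [Finset.sum_eq_single (k (hi n j)) (fun c _ hc => by simp [hc.symm]) (by simp)]
  by_cases hk : k (lo n j) < k (hi n j)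
  · rw [Finset.sum_eq_single (k (lo n j)) (fun c _ hc => by simp [hc.symm]) (by simp [hk])]
    simp only [if_true, if_pos hk]
    have := Δ.inv_mul
    linear_combination (((Δ⁻¹ : Rˣ) : R) * Δ + 1) * (u (k (hi n j)) - u (k (lo n j))) *
      ((q : R) - ((q⁻¹ : Rˣ) : R)) * this
  · rw [Finset.sum_eq_zero fun c hc => ?_, if_neg hk, zero_mul]
    have : k (lo n j) ≠ c := fun e => hk (e ▸ (Finset.mem_filter.1 hc).2)
    simp [this]

theorem TT_eq (hψ : ∀ f, ψ f = ∑ k, f k • b R n r q Δ u F k) (j : Fin (n - 1)) :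
    TT R n r q Δ u F j = g R n r q Δ u F j +
      ψ (ltFun r ((q : R) - ((q⁻¹ : Rˣ) : R)) (lo n j) (hi n j)) := by
  have h : B' R n r q Δ u F (lo n j) (hi n j) =
      -ψ (ltFun r ((q : R) - ((q⁻¹ : Rˣ) : R)) (lo n j) (hi n j)) := by
    rw [B', hψ, Finset.smul_sum, Finset.sum_filter]
    simp only [ltFun, ite_smul, zero_smul]
  rw [g, h, neg_add_cancel_right]

theorem g_mul_tt (hFeval : ∀ c c' : Fin r, (F c).eval (u c') = if c' = c then (Δ : R) else 0)
    (hψ : ∀ i, ψ (fun k => u (k i)) = tt R n r q Δ u F i)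
    (hψ' : ∀ f, ψ f = ∑ k, f k • b R n r q Δ u F k) (j : Fin (n - 1)) (i : Fin n) :
    g R n r q Δ u F j * tt R n r q Δ u F i =
      tt R n r q Δ u F (simple n j i) * g R n r q Δ u F j := by
  have hcomm : ∀ f i, tt R n r q Δ u F i * ψ f = ψ f * tt R n r q Δ u F i := by
    intro f i
    rw [← hψ, ← map_mul, mul_comm, map_mul]
  rw [← sub_eq_of_eq_add (TT_eq hψ' j), sub_mul, mul_sub]
  by_cases h1 : i = lo n j
  · subst h1
    rw [TT_mul_tt_lo, pim_Bel hFeval hψ, simple_lo, hcomm]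
    rw [mul_sub]
    abel
  by_cases h2 : i = hi n j
  · subst h2
    rw [TT_mul_tt_hi, pim_Bel hFeval hψ, simple_hi, hcomm]
    rw [mul_sub]
    abel
  rw [simple_of_ne j h1 h2, TT_mul_tt_of_ne j h1 h2, hcomm]

end Hnr

end MAK

/-- Lemma 4.1: `τ(g_w g_{w'}) = δ(w' = w⁻¹)`, and more generally
`τ(A g_w g_{w'}) = δ(w' = w⁻¹) τ(A)` for `A ∈ R[t_1,…,t_n]`. -/
theorem statement13
    (R : Type*) [CommRing R] [IsDomain R] (n r : ℕ) (hn : 1 ≤ n) (hr : 1 ≤ r)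
    (q Δ : Rˣ) (u : Fin r → R) (F : Fin r → R[X])
    (hΔ : (Δ : R) = ∏ i : Fin r, ∏ j ∈ Finset.univ.filter (fun j => j < i), (u i - u j))
    (hFdeg : ∀ c : Fin r, (F c).degree = ((r - 1 : ℕ) : WithBot ℕ))
    (hFeval : ∀ c c' : Fin r, (F c).eval (u c') = if c' = c then (Δ : R) else 0)
    (τ : Hnr R n r q Δ u F →ₗ[R] R)
    (hτ : ∀ c : Fin n → ℕ, (∀ i, c i ≤ r - 1) →
      ∀ (w : Equiv.Perm (Fin n)) (l : List (Fin (n - 1))), IsReducedWord n w l →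
        τ (tmon R n r q Δ u F c * gword R n r q Δ u F l) = if w = 1 ∧ c = 0 then 1 else 0) :
    (∀ (w w' : Equiv.Perm (Fin n)) (lw lw' : List (Fin (n - 1))),
        IsReducedWord n w lw → IsReducedWord n w' lw' →
          τ (gword R n r q Δ u F lw * gword R n r q Δ u F lw') = if w' = w⁻¹ then 1 else 0) ∧
    (∀ A ∈ Algebra.adjoin R (Set.range (tt R n r q Δ u F)),
      ∀ (w w' : Equiv.Perm (Fin n)) (lw lw' : List (Fin (n - 1))),
        IsReducedWord n w lw → IsReducedWord n w' lw' →
          τ (A * gword R n r q Δ u F lw * gword R n r q Δ u F lw') = if w' = w⁻¹ then τ A else 0) := by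
  have hu := isUnit_sub_of_prod hΔ
  obtain ⟨ψ, hψ, hψ', hspan⟩ := exists_function_algHom hr hu (tt R n r q Δ u F) tt_comm
    aeval_tt_prod
  have hx : ∀ j f, g R n r q Δ u F j * ψ f =
      ψ (fun k => f (k ∘ simple n j)) * g R n r q Δ u F j := by
    intro j
    refine mul_map_eq_of_coord hu fun i => ?_
    rw [hψ, hψ, g_mul_tt hFeval hψ hψ']
  have hx2 : ∀ j, g R n r q Δ u F j * g R n r q Δ u F j = 1 +
      ψ (eqFun r ((q : R) - ((q⁻¹ : Rˣ) : R)) (lo n j) (hi n j)) * g R n r q Δ u F j := by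
    intro j
    refine mul_self_of_quadratic hx ?_
    rw [← TT_eq hψ', TT_mul_self]
  have hbraid : ∀ j k : Fin (n - 1), k.1 = j.1 + 1 →
      g R n r q Δ u F j * g R n r q Δ u F k * g R n r q Δ u F j =
        g R n r q Δ u F k * g R n r q Δ u F j * g R n r q Δ u F k := by
    intro j k hjk
    refine braid_of_braid hx hx2 hjk ?_
    rw [← TT_eq hψ', ← TT_eq hψ', TT_braid hjk]
  have hcomm : ∀ j k : Fin (n - 1), j.1 + 2 ≤ k.1 →
      g R n r q Δ u F j * g R n r q Δ u F k = g R n r q Δ u F k * g R n r q Δ u F j := by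
    intro j k hjk
    refine comm_of_comm (c := (q : R) - ((q⁻¹ : Rˣ) : R)) hx hjk ?_
    rw [← TT_eq hψ', ← TT_eq hψ', TT_comm hjk]
  have hτ' : ∀ f (w : Equiv.Perm (Fin n)) (l : List (Fin (n - 1))), IsReducedWord n w l →
      τ (ψ f * (l.map (g R n r q Δ u F)).prod) = if w = 1 then τ (ψ f) else 0 := by
    intro f w l hl
    refine Submodule.span_induction (p := fun a _ =>
      τ (a * (l.map (g R n r q Δ u F)).prod) = if w = 1 then τ a else 0) ?_ ?_ ?_ ?_ (hspan f)
    · rintro _ ⟨c, hc, rfl⟩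
      have h1 := hτ c hc w l hl
      have h2 := hτ c hc 1 [] (isReducedWord_nil_iff.2 rfl)
      simp only [gword, List.map_nil, List.prod_nil, mul_one, true_and] at h1 h2
      change τ (tmon R n r q Δ u F c * _) = if w = 1 then τ (tmon R n r q Δ u F c) else 0
      rw [h1, h2, ite_and]
    · simp
    · intro a a' _ _ ha ha'
      rw [add_mul, map_add, ha, ha', map_add]
      split_ifs <;> simp
    · intro s a _ ha
      rw [smul_mul_assoc, map_smul, ha, map_smul]
      split_ifs <;> simp
  have main : ∀ A ∈ Algebra.adjoin R (Set.range (tt R n r q Δ u F)),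
      ∀ (w w' : Equiv.Perm (Fin n)) (lw lw' : List (Fin (n - 1))),
        IsReducedWord n w lw → IsReducedWord n w' lw' →
          τ (A * gword R n r q Δ u F lw * gword R n r q Δ u F lw') =
            if w' = w⁻¹ then τ A else 0 := by
    intro A hA w w' l l' hl hl'
    have hle : Algebra.adjoin R (Set.range (tt R n r q Δ u F)) ≤ ψ.range :=
      Algebra.adjoin_le (by rintro _ ⟨i, rfl⟩; exact ⟨_, hψ i⟩)
    obtain ⟨f, rfl⟩ := hle hA
    exact trace_mul_prod_mul_prod hx hx2 hbraid hcomm hτ' hl hl' f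
  refine ⟨fun w w' l l' hl hl' => ?_, main⟩
  have h1 : τ 1 = 1 := by
    have h := hτ 0 (fun _ => Nat.zero_le _) 1 [] (isReducedWord_nil_iff.2 rfl)
    simpa [gword, tmon] using h
  have h := main 1 (one_mem _) w w' l l' hl hl'
  rwa [one_mul, h1] at h
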